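/- Let n ≥ 2, p ∈ {1,…,n−1} with gcd(n,p) = 1, q ∈ {1,…,n−1} with pq ≡ 1 (mod n), and let y be a type (i) coupling from the first interval (p/n − 1/(nq))π < y < pπ/n, so M = pπ − ny > 0. Then for every ξ ∈ A_y^+, every θ ∈ ℝ^{n−1}, and all j, ℓ ∈ {1,…,n}: Δ_j(θ)⁻¹ · L(ξ,θ)_{j,ℓ} · Δ_ℓ(θ) = [ conj(u_j)·u_{σ(ℓ)} / ( |u_j(ξ)|·|u_{σ(ℓ)}(ξ)| ) ] · L(ξ,0)_{j,ℓ}, where u = ℰ(ξ,θ) and σ(ℓ) = ℓ+n−p if 1 ≤ ℓ ≤ p, σ(ℓ) = ℓ−p if p < ℓ ≤ n. (This is the local-coordinate form of the statement that the smooth matrix L^{y,+} on ℂP^{n−1} extends the conjugated local Lax matrix.) -/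

import Mathlib

open Finset Matrix
open scoped BigOperators Real

noncomputable section

/-- Entries of the `(n-1) × (n-1)` integer matrix `A` (1-based indices):
`A_{j,k} = 1` if `1 ≤ j ≤ n-p` and `j ≤ k < j+p`, `A_{j,k} = -1` if
`n-p < j ≤ n-1` and `j+p-n ≤ k < j`, and `0` otherwise. -/
def Aent (n p : ℕ) (j k : ℕ) : ℤ :=
  if j ≤ n - p ∧ j ≤ k ∧ k < j + p then 1
  else if n - p < j ∧ j + p ≤ k + n ∧ k < j then -1
  else 0

open Classical in
/-- Entries of the binary matrix `B`: `B_{m,k} = 0` iff `k - m ≡ ℓ p (mod n)`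
for some `ℓ ∈ {1, …, n-q}`, else `1`. -/
def Bent (n p q : ℕ) (m k : ℕ) : ℤ :=
  if ∃ ℓ ∈ Finset.Icc 1 (n - q), ((k : ℤ) - (m : ℤ)) ≡ ((ℓ * p : ℕ) : ℤ) [ZMOD (n : ℤ)]
  then 0 else 1

open Classical in
/-- Entries of the binary matrix `C`: `C_{m,k} = 0` iff `k ≡ ℓ p (mod n)`
for some `ℓ ∈ {1, …, n-q}`, else `1`. -/
def Cent (n p q : ℕ) (m k : ℕ) : ℤ :=
  if ∃ ℓ ∈ Finset.Icc 1 (n - q), ((k : ℤ)) ≡ ((ℓ * p : ℕ) : ℤ) [ZMOD (n : ℤ)]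
  then 0 else 1

/-- Entries of `Ω = B - C`. -/
def Ωent (n p q : ℕ) (m k : ℕ) : ℤ := Bent n p q m k - Cent n p q m k

/-- The matrix `A` as an `(n-1) × (n-1)` integer matrix. -/
def Amat (n p : ℕ) : Matrix (Fin (n - 1)) (Fin (n - 1)) ℤ :=
  fun j k => Aent n p (j.1 + 1) (k.1 + 1)

/-- The matrix `Ω = B - C` as an `(n-1) × (n-1)` integer matrix. -/
def Ωmat (n p q : ℕ) : Matrix (Fin (n - 1)) (Fin (n - 1)) ℤ :=
  fun j k => Ωent n p q (j.1 + 1) (k.1 + 1)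

/-- Cyclic window sum `ξ_ℓ + ξ_{ℓ+1} + ⋯ + ξ_{ℓ+d-1}`. -/
def wsum (ξ : ℕ → ℝ) (ℓ d : ℕ) : ℝ := ∑ m ∈ Finset.range d, ξ (ℓ + m)

/-- First type (i) interval: `(p/n - 1/(nq))π < y < pπ/n` (so `M = pπ - ny > 0`). -/
def typeI1 (n p q : ℕ) (y : ℝ) : Prop :=
  ((p : ℝ) / n - 1 / ((n : ℝ) * q)) * Real.pi < y ∧ y < (p : ℝ) * Real.pi / n

/-- Second type (i) interval: `pπ/n < y < (p/n + 1/(n(n-q)))π` (so `M = pπ - ny < 0`). -/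
def typeI2 (n p q : ℕ) (y : ℝ) : Prop :=
  (p : ℝ) * Real.pi / n < y ∧ y < ((p : ℝ) / n + 1 / ((n : ℝ) * ((n : ℝ) - q))) * Real.pi

/-- `M = pπ - ny`. -/
def Mval (n p : ℕ) (y : ℝ) : ℝ := (p : ℝ) * Real.pi - (n : ℝ) * y

/-- Membership of `ξ` (a cyclic sequence of reals, indices `1, …, n`) in the open
domain `A_y^+`: cyclic convention `ξ_{m+n} = ξ_m`, positivity, total sum `π`, and
`sgn(M)(ξ_j + ⋯ + ξ_{j+p-1} - y) > 0` for `j = 1, …, n`. -/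
def inAy (n p : ℕ) (y : ℝ) (ξ : ℕ → ℝ) : Prop :=
  (∀ m, ξ (m + n) = ξ m) ∧
  (∀ k, 1 ≤ k → k ≤ n → 0 < ξ k) ∧
  (∑ k ∈ Finset.Icc 1 n, ξ k = Real.pi) ∧
  (∀ j, 1 ≤ j → j ≤ n → 0 < Real.sign (Mval n p y) * (wsum ξ j p - y))

/-- `|u_j(ξ)|² = sgn(M) (ξ_j + ⋯ + ξ_{j+p-1} - y)`. -/
def usq (n p : ℕ) (y : ℝ) (ξ : ℕ → ℝ) (j : ℕ) : ℝ :=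
  Real.sign (Mval n p y) * (wsum ξ j p - y)

/-- `z_ℓ(ξ, w) = sgn(sin(ny)) ∏_{d=1}^{n-1} sin(ξ_ℓ + ⋯ + ξ_{ℓ+d-1} - w)/sin(ξ_ℓ + ⋯ + ξ_{ℓ+d-1})`;
the paper's `z_ℓ(ξ, ±y)` is obtained at `w = ±y`. -/
def zfun (n : ℕ) (y : ℝ) (ξ : ℕ → ℝ) (w : ℝ) (ℓ : ℕ) : ℝ :=
  Real.sign (Real.sin ((n : ℝ) * y)) *
    ∏ d ∈ Finset.Icc 1 (n - 1), Real.sin (wsum ξ ℓ d - w) / Real.sin (wsum ξ ℓ d)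

/-- `x_j - x_ℓ` expressed through `ξ`: `ξ_ℓ + ⋯ + ξ_{j-1}` for `ℓ ≤ j`, antisymmetric. -/
def xdiff (ξ : ℕ → ℝ) (j ℓ : ℕ) : ℝ :=
  if ℓ ≤ j then wsum ξ ℓ (j - ℓ) else -(wsum ξ j (ℓ - j))

/-- `ρ(θ)_ℓ = exp(i(θ_{ℓ-1} - θ_ℓ))` (with the conventions `θ_0 = θ_n = 0` imposed
as hypotheses on `θ`). -/
def ρfun (θ : ℕ → ℝ) (ℓ : ℕ) : ℂ :=
  Complex.exp (Complex.I * ((θ (ℓ - 1) - θ ℓ : ℝ) : ℂ))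

/-- `Δ_j(θ) = exp(i Σ_{k=1}^{n-1} Ω_{j,k} θ_k)` for `1 ≤ j ≤ n-1`, and `Δ_n(θ) = 1`. -/
def Δfun (n p q : ℕ) (θ : ℕ → ℝ) (j : ℕ) : ℂ :=
  if j = n then 1
  else Complex.exp (Complex.I *
    ((∑ k ∈ Finset.Icc 1 (n - 1), (Ωent n p q j k : ℝ) * θ k : ℝ) : ℂ))

/-- The local trigonometric Lax matrix
`L(ξ,θ)_{j,ℓ} = [sin y / sin(x_j - x_ℓ + y)] v_j(ξ,y) v_ℓ(ξ,-y) ρ(θ)_ℓ`. -/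
def Lloc (n : ℕ) (y : ℝ) (ξ θ : ℕ → ℝ) (j ℓ : ℕ) : ℂ :=
  ((Real.sin y / Real.sin (xdiff ξ j ℓ + y) : ℝ) : ℂ) *
    ((Real.sqrt (zfun n y ξ y j) : ℝ) : ℂ) *
    ((Real.sqrt (zfun n y ξ (-y) ℓ) : ℝ) : ℂ) * ρfun θ ℓ

/-- The embedding map `ℰ(ξ,θ)_j = |u_j(ξ)| Δ_j(θ)^{sgn M}` for `j = 1, …, n-1`
and `ℰ(ξ,θ)_n = |u_n(ξ)|` (note `Δ_n = 1`). -/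
def Emap (n p q : ℕ) (y : ℝ) (ξ θ : ℕ → ℝ) (j : ℕ) : ℂ :=
  ((Real.sqrt (usq n p y ξ j) : ℝ) : ℂ) *
    Δfun n p q θ j ^ (if 0 < Mval n p y then (1 : ℤ) else -1)

/-- `σ(ℓ) = ℓ + n - p` if `1 ≤ ℓ ≤ p`, and `σ(ℓ) = ℓ - p` if `p < ℓ ≤ n`. -/
def σmap (n p : ℕ) (ℓ : ℕ) : ℕ := if ℓ ≤ p then ℓ + n - p else ℓ - p

/-- The Weierstrass-type function
`ws_b(z) = sin z ∏_{m=1}^∞ (1 + sin² z / sinh²(2 m b))` with `ω = π/2`, `ω' = i b`. -/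
def wsb (b : ℝ) (z : ℂ) : ℂ :=
  Complex.sin z *
    ∏' m : ℕ, (1 + Complex.sin z ^ 2 / Complex.sinh (2 * ((m : ℂ) + 1) * (b : ℂ)) ^ 2)

/-- Elliptic analogue of `zfun`, built from `ws_b` instead of `sin`. -/
def zbfun (b : ℝ) (n : ℕ) (y : ℝ) (ξ : ℕ → ℝ) (w : ℝ) (ℓ : ℕ) : ℝ :=
  Real.sign ((wsb b (((n : ℝ) * y : ℝ) : ℂ)).re) *
    ∏ d ∈ Finset.Icc 1 (n - 1),
      (wsb b ((wsum ξ ℓ d - w : ℝ) : ℂ)).re / (wsb b ((wsum ξ ℓ d : ℝ) : ℂ)).re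

/-- The local elliptic Lax matrix with spectral parameter `lam`. -/
def Lbloc (b : ℝ) (n : ℕ) (y : ℝ) (lam : ℂ) (ξ θ : ℕ → ℝ) (j ℓ : ℕ) : ℂ :=
  (wsb b ((y : ℝ) : ℂ) / wsb b lam) *
    (wsb b (((xdiff ξ j ℓ : ℝ) : ℂ) + lam) / wsb b ((xdiff ξ j ℓ + y : ℝ) : ℂ)) *
    ((Real.sqrt (zbfun b n y ξ y j) : ℝ) : ℂ) *
    ((Real.sqrt (zbfun b n y ξ (-y) ℓ) : ℝ) : ℂ) * ρfun θ ℓ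

/-- The subset `S = {ℓ p mod n : ℓ = 1, …, n-q}` of `ℤ/nℤ`. -/
def Sset (n p q : ℕ) : Finset (ZMod n) :=
  (Finset.Icc 1 (n - q)).image (fun ℓ => ((ℓ * p : ℕ) : ZMod n))

/-- The subset `S_i = {i + ℓ mod n : ℓ = 0, …, p-1}` of `ℤ/nℤ`. -/
def Siset (n p : ℕ) (i : ZMod n) : Finset (ZMod n) :=
  (Finset.range p).image (fun ℓ : ℕ => i + (ℓ : ZMod n))

/-- `I_i = |S_i ∩ S|`. -/
def Inum (n p q : ℕ) (i : ZMod n) : ℕ := (Siset n p i ∩ Sset n p q).card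

/-- The function `W_j(ξ)` of Statement 13. -/
def Wfun (n p : ℕ) (y : ℝ) (ξ : ℕ → ℝ) (j : ℕ) : ℝ :=
  (Real.sin (usq n p y ξ j) / usq n p y ξ j) *
    ((-1 : ℝ) ^ (p - 1) / Real.sin (wsum ξ j p)) *
    ∏ d ∈ (Finset.Icc 1 (n - 1)).erase p,
      Real.sin (wsum ξ j d - y) / Real.sin (wsum ξ j d)

theorem exists_modEq_mul_iff {n p q : ℕ} (hq1 : 1 ≤ q) (hqn : q < n)
    (hpq : (p : ℤ) * q ≡ 1 [ZMOD n]) (a : ℤ) :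
    (∃ i ∈ Finset.Icc 1 (n - q), a ≡ ((i * p : ℕ) : ℤ) [ZMOD (n : ℤ)]) ↔
      1 ≤ a * q % n ∧ a * q % n ≤ n - q := by
  constructor
  · rintro ⟨i, hi, h⟩
    rw [Finset.mem_Icc] at hi
    have h1 : a * q ≡ i [ZMOD n] :=
      (h.mul_right q).trans (by simpa [mul_assoc] using hpq.mul_left i)
    have h2 : a * q % n = i := by
      rw [h1]
      exact Int.emod_eq_of_lt (by omega) (by omega)
    omega
  · rintro ⟨h1, h2⟩
    refine ⟨(a * q % n).toNat, Finset.mem_Icc.2 ⟨by omega, by omega⟩, ?_⟩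
    rw [Nat.cast_mul, Int.toNat_of_nonneg (by omega)]
    have h3 : a * q % n ≡ a * q [ZMOD n] := Int.mod_modEq _ _
    have h4 : a * q * p ≡ a [ZMOD n] := by
      have := hpq.mul_left a
      rwa [mul_one, mul_comm (p : ℤ), ← mul_assoc] at this
    exact ((h3.mul_right p).trans h4).symm

theorem modEq_iff_mul_emod_eq {n p q : ℕ} (hpq : (p : ℤ) * q ≡ 1 [ZMOD n]) (a b : ℤ) :
    a ≡ b [ZMOD n] ↔ a * q % n = b * q % n := by
  refine ⟨fun h => h.mul_right q, fun h => ?_⟩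
  have h1 : a * q * p ≡ b * q * p [ZMOD n] := Int.ModEq.mul_right _ h
  have h2 (c : ℤ) : c * q * p ≡ c [ZMOD n] := by
    have := hpq.mul_left c
    rwa [mul_one, mul_comm (p : ℤ), ← mul_assoc] at this
  exact ((h2 a).symm.trans h1).trans (h2 b)

theorem Bent_eq {n p q : ℕ} (hq1 : 1 ≤ q) (hqn : q < n)
    (hpq : (p : ℤ) * q ≡ 1 [ZMOD n]) (m k : ℕ) :
    Bent n p q m k = if 1 ≤ ((k : ℤ) - m) * q % n ∧ ((k : ℤ) - m) * q % n ≤ n - q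
      then 0 else 1 := by
  simp only [Bent, exists_modEq_mul_iff hq1 hqn hpq]

theorem σmap_mem {n p ℓ : ℕ} (hpn : p < n) (hℓ1 : 1 ≤ ℓ) (hℓn : ℓ ≤ n) :
    1 ≤ σmap n p ℓ ∧ σmap n p ℓ ≤ n := by
  unfold σmap
  split_ifs <;> omega

theorem σmap_modEq {n p ℓ : ℕ} (hpn : p < n) :
    (σmap n p ℓ : ℤ) ≡ ℓ - p [ZMOD n] := by
  unfold σmap
  split_ifs with h
  · exact Int.modEq_iff_dvd.2 ⟨-1, by omega⟩
  · rw [Nat.cast_sub (by omega)]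

theorem Ωent_σmap {n p q ℓ k : ℕ} (hpn : p < n) (hq1 : 1 ≤ q) (hqn : q < n)
    (hpq : (p : ℤ) * q ≡ 1 [ZMOD n]) (hℓ1 : 1 ≤ ℓ) (hℓn : ℓ ≤ n)
    (hk1 : 1 ≤ k) (hkn : k < n) :
    Ωent n p q (σmap n p ℓ) k =
      Ωent n p q ℓ k - (if k = ℓ then 1 else 0) + (if k = ℓ - 1 then 1 else 0) := by
  have hn : (0 : ℤ) < n := by omega
  set r : ℤ := ((k : ℤ) - ℓ) * q % n with hr
  have hr0 : 0 ≤ r := Int.emod_nonneg _ hn.ne'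
  have hrn : r < n := Int.emod_lt_of_pos _ hn
  have hσ : ((k : ℤ) - σmap n p ℓ) * q % n = if r + 1 = n then 0 else r + 1 := by
    have h1 : ((k : ℤ) - σmap n p ℓ) * q ≡ ((k : ℤ) - (ℓ - p)) * q [ZMOD n] :=
      ((Int.ModEq.refl _).sub (σmap_modEq hpn)).mul_right _
    have h2 : ((k : ℤ) - (ℓ - p)) * q ≡ r + 1 [ZMOD n] := by
      have h3 : ((k : ℤ) - ℓ) * q ≡ r [ZMOD n] := (Int.mod_modEq _ _).symm
      convert h3.add hpq using 1
      ring
    have h4 : ((k : ℤ) - σmap n p ℓ) * q % n = (r + 1) % n := h1.trans h2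
    rw [h4]
    split_ifs with h
    · rw [h, Int.emod_self]
    · exact Int.emod_eq_of_lt (by omega) (by omega)
  have hzero : k = ℓ ↔ r = 0 := by
    have h := modEq_iff_mul_emod_eq hpq ((k : ℤ) - ℓ) 0
    rw [zero_mul, Int.zero_emod, ← hr] at h
    rw [← h]
    constructor
    · rintro rfl
      simp
    · intro h'
      rcases lt_trichotomy k ℓ with hlt | heq | hlt
      · have := Int.le_of_dvd (by omega) (Int.modEq_iff_dvd.1 h')
        omega
      · exact heq
      · have := Int.le_of_dvd (by omega) (Int.modEq_iff_dvd.1 h'.symm)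
        omega
  have hneg : k = ℓ - 1 ↔ r = n - q := by
    have h := modEq_iff_mul_emod_eq hpq ((k : ℤ) - ℓ) (-1)
    have h1 : (-1 * (q : ℤ)) % n = n - q := by
      rw [← Int.add_emod_right, Int.emod_eq_of_lt] <;> omega
    rw [h1, ← hr] at h
    rw [← h]
    constructor
    · rintro rfl
      rw [Nat.cast_sub hℓ1]
      simp
    · intro h'
      rcases lt_trichotomy k (ℓ - 1) with hlt | heq | hlt
      · have := Int.le_of_dvd (by omega) (Int.modEq_iff_dvd.1 h')
        omega
      · exact heq
      · have := Int.le_of_dvd (by omega) (Int.modEq_iff_dvd.1 h'.symm)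
        omega
  have hC : Cent n p q (σmap n p ℓ) k = Cent n p q ℓ k := rfl
  simp only [Ωent, Bent_eq hq1 hqn hpq, ← hr, hzero, hneg, hC]
  generalize ((k : ℤ) - σmap n p ℓ) * q % n = s at hσ ⊢
  split_ifs at hσ ⊢ <;> omega

theorem Ωent_self_left (n p q k : ℕ) : Ωent n p q n k = 0 := by
  have h (a : ℤ) : (k : ℤ) - n ≡ a [ZMOD n] ↔ (k : ℤ) ≡ a [ZMOD n] := by
    simp [Int.ModEq]
  simp only [Ωent, Bent, Cent, h, sub_self]

theorem Δfun_eq_exp (n p q : ℕ) (θ : ℕ → ℝ) (j : ℕ) :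
    Δfun n p q θ j = Complex.exp (Complex.I *
      ((∑ k ∈ Finset.Icc 1 (n - 1), (Ωent n p q j k : ℝ) * θ k : ℝ) : ℂ)) := by
  unfold Δfun
  split_ifs with h
  · simp [h, Ωent_self_left]
  · rfl

theorem ρfun_mul_Δfun {n p q ℓ : ℕ} (hpn : p < n) (hq1 : 1 ≤ q) (hqn : q < n)
    (hpq : (p : ℤ) * q ≡ 1 [ZMOD n]) (hℓ1 : 1 ≤ ℓ) (hℓn : ℓ ≤ n)
    {θ : ℕ → ℝ} (hθ0 : θ 0 = 0) (hθn : θ n = 0) :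
    ρfun θ ℓ * Δfun n p q θ ℓ = Δfun n p q θ (σmap n p ℓ) := by
  have hs : ∑ k ∈ Finset.Icc 1 (n - 1), (Ωent n p q (σmap n p ℓ) k : ℝ) * θ k =
      (θ (ℓ - 1) - θ ℓ) + ∑ k ∈ Finset.Icc 1 (n - 1), (Ωent n p q ℓ k : ℝ) * θ k := by
    have h1 : ∑ k ∈ Finset.Icc 1 (n - 1), (if k = ℓ then θ k else 0) = θ ℓ := by
      rw [Finset.sum_ite_eq']
      split_ifs with h
      · rfl
      · obtain rfl : ℓ = n := by
          rw [Finset.mem_Icc] at h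
          omega
        exact hθn.symm
    have h2 : ∑ k ∈ Finset.Icc 1 (n - 1), (if k = ℓ - 1 then θ k else 0) = θ (ℓ - 1) := by
      rw [Finset.sum_ite_eq']
      split_ifs with h
      · rfl
      · have h0 : ℓ - 1 = 0 := by
          rw [Finset.mem_Icc] at h
          omega
        rw [h0, hθ0]
    rw [← h1, ← h2, ← Finset.sum_sub_distrib, ← Finset.sum_add_distrib]
    refine Finset.sum_congr rfl fun k hk => ?_
    rw [Finset.mem_Icc] at hk
    rw [Ωent_σmap hpn hq1 hqn hpq hℓ1 hℓn hk.1 (by omega)]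
    push_cast
    split_ifs <;> ring
  rw [Δfun_eq_exp, Δfun_eq_exp, ρfun, ← Complex.exp_add, hs]
  congr 1
  push_cast
  ring

theorem conj_Δfun (n p q : ℕ) (θ : ℕ → ℝ) (j : ℕ) :
    starRingEnd ℂ (Δfun n p q θ j) = (Δfun n p q θ j)⁻¹ := by
  rw [Δfun_eq_exp, ← Complex.exp_conj, ← Complex.exp_neg]
  simp only [map_mul, Complex.conj_I, Complex.conj_ofReal, neg_mul]

theorem Lloc_eq_mul_ρfun (n : ℕ) (y : ℝ) (ξ θ : ℕ → ℝ) (j ℓ : ℕ) :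
    Lloc n y ξ θ j ℓ = Lloc n y ξ (fun _ => 0) j ℓ * ρfun θ ℓ := by
  simp [Lloc, ρfun]

/-- For a type (i) coupling from the first interval (`M > 0`):
`Δ_j(θ)⁻¹ L(ξ,θ)_{j,ℓ} Δ_ℓ(θ) = [conj(u_j) u_{σ(ℓ)} / (|u_j(ξ)| |u_{σ(ℓ)}(ξ)|)] · L(ξ,0)_{j,ℓ}`
with `u = ℰ(ξ,θ)`. -/
theorem stmt6 (n p q : ℕ) (hn : 2 ≤ n) (hp1 : 1 ≤ p) (hpn : p ≤ n - 1)
    (hgcd : Nat.gcd n p = 1) (hq1 : 1 ≤ q) (hqn : q ≤ n - 1)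
    (hpq : p * q ≡ 1 [MOD n])
    (y : ℝ) (hy : typeI1 n p q y)
    (ξ : ℕ → ℝ) (hξ : inAy n p y ξ)
    (θ : ℕ → ℝ) (hθ0 : θ 0 = 0) (hθn : θ n = 0)
    (j ℓ : ℕ) (hj1 : 1 ≤ j) (hjn : j ≤ n) (hℓ1 : 1 ≤ ℓ) (hℓn : ℓ ≤ n) :
    (Δfun n p q θ j)⁻¹ * Lloc n y ξ θ j ℓ * Δfun n p q θ ℓ =
      (starRingEnd ℂ (Emap n p q y ξ θ j) * Emap n p q y ξ θ (σmap n p ℓ)) /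
        (((Real.sqrt (usq n p y ξ j) * Real.sqrt (usq n p y ξ (σmap n p ℓ)) : ℝ)) : ℂ) *
        Lloc n y ξ (fun _ => 0) j ℓ := by
  have hn0 : (0 : ℝ) < n := by
    exact_mod_cast (by omega : 0 < n)
  have hM : 0 < Mval n p y := by
    have h := (lt_div_iff₀ hn0).1 hy.2
    unfold Mval
    linarith
  have hpq' : (p : ℤ) * q ≡ 1 [ZMOD n] := by
    exact_mod_cast (Int.natCast_modEq_iff.2 hpq)
  have hu (i : ℕ) (h1 : 1 ≤ i) (h2 : i ≤ n) : ((Real.sqrt (usq n p y ξ i) : ℝ) : ℂ) ≠ 0 :=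
    Complex.ofReal_ne_zero.2 (Real.sqrt_pos.2 (hξ.2.2.2 i h1 h2)).ne'
  have hσ := σmap_mem (p := p) (by omega) hℓ1 hℓn
  have huj := hu j hj1 hjn
  have huσ := hu _ hσ.1 hσ.2
  have hphase := ρfun_mul_Δfun (n := n) (p := p) (q := q) (ℓ := ℓ)
    (by omega) hq1 (by omega) hpq' hℓ1 hℓn hθ0 hθn
  simp only [Emap, if_pos hM, zpow_one, map_mul, Complex.conj_ofReal, conj_Δfun]
  rw [← hphase, Lloc_eq_mul_ρfun n y ξ θ, Complex.ofReal_mul]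
  field_simp

end
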